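/- The function û : ℝ → ℝ is upper semicontinuous; in particular, for every z* ∈ ℝ, lim sup_{z ↑ z*} û(z) ≤ û(z*). -/

import Mathlib

open MeasureTheory Real Set Filter
open scoped ENNReal

/-- The subjective expected utility of an agent with immediate value `V`, future value `w`,
subjective present-bias factor `βh`, facing no-show penalty `z`:
`û(z) = E[(V + w)·1{V ≥ -z - β̂·w}] - z·P(V < -z - β̂·w)`. -/
noncomputable def uhat {Ω : Type*} [MeasurableSpace Ω] (P : Measure Ω)
    (V : Ω → ℝ) (w βh : ℝ) (z : ℝ) : ℝ :=
  (∫ ω in {ω | V ω ≥ -z - βh * w}, (V ω + w) ∂P)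
    - z * (P {ω | V ω < -z - βh * w}).toReal

/-- A monotone right-continuous real function is upper semicontinuous. -/
lemma StieltjesFunction.upperSemicontinuous (f : StieltjesFunction ℝ) :
    UpperSemicontinuous f := by
  intro x y hxy
  have hright : ∀ᶠ z in nhdsWithin x (Ici x), f z < y :=
    (f.right_continuous x).eventually (Iio_mem_nhds hxy)
  rw [eventually_nhdsWithin_iff] at hright
  filter_upwards [hright] with z hz
  rcases le_total x z with h | h
  · exact hz h
  · exact (f.mono h).trans_lt hxy

section

variable {Ω : Type*} [MeasurableSpace Ω] {P : Measure Ω} [IsProbabilityMeasure P] {V : Ω → ℝ}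

/-- Integrability of the positive part does not depend on the shift. -/
lemma integrable_max_add_zero (hV : Measurable V) {a : ℝ}
    (ha : Integrable (fun ω => max (V ω + a) 0) P) (b : ℝ) :
    Integrable (fun ω => max (V ω + b) 0) P := by
  refine (ha.add (integrable_const |b - a|)).mono'
    ((hV.add_const b).max measurable_const).aestronglyMeasurable (ae_of_all _ fun ω => ?_)
  rw [Real.norm_of_nonneg (le_max_right _ _)]
  refine max_le ?_ (add_nonneg (le_max_right _ _) (abs_nonneg _))
  change V ω + b ≤ max (V ω + a) 0 + |b - a|
  linarith [le_max_left (V ω + a) 0, le_abs_self (b - a)]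

/-- The expected positive part is continuous in the shift. -/
lemma continuous_integral_max_add_zero
    (hint : ∀ b : ℝ, Integrable (fun ω => max (V ω + b) 0) P) :
    Continuous fun b : ℝ => ∫ ω, max (V ω + b) 0 ∂P := by
  refine (LipschitzWith.of_dist_le_mul (K := 1) fun b c => ?_).continuous
  rw [dist_eq_norm, ← integral_sub (hint b) (hint c)]
  refine (norm_integral_le_of_norm_le_const (C := |b - c|) (ae_of_all _ fun ω => ?_)).trans ?_
  · simpa using abs_max_sub_max_le_abs (V ω + b) (V ω + c) 0
  · simp [Real.dist_eq]

/-- `û(z) = -z + E[(V + z + β̂·w)⁺] + (1 - β̂)·w·P(-V - β̂·w ≤ z)`. -/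
lemma uhat_eq (hV : Measurable V) (w βh z : ℝ)
    (hint : Integrable (fun ω => max (V ω + (z + βh * w)) 0) P) :
    uhat P V w βh z = -z + ∫ ω, max (V ω + (z + βh * w)) 0 ∂P
      + (1 - βh) * w * ProbabilityTheory.cdf (P.map fun ω => -V ω - βh * w) z := by
  have hmeas : Measurable fun ω => -V ω - βh * w := hV.neg.sub_const _
  have : IsProbabilityMeasure (P.map fun ω => -V ω - βh * w) :=
    Measure.isProbabilityMeasure_map hmeas.aemeasurable
  set A : Set Ω := {ω | V ω ≥ -z - βh * w} with hA
  have hAm : MeasurableSet A := measurableSet_le measurable_const hV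
  have hcdf : ProbabilityTheory.cdf (P.map fun ω => -V ω - βh * w) z = P.real A := by
    rw [ProbabilityTheory.cdf_eq_real, map_measureReal_apply hmeas measurableSet_Iic]
    congr 1
    ext ω
    simp only [mem_preimage, mem_Iic, hA, mem_ofPred_eq]
    constructor <;> intro h <;> linarith
  have hcompl : {ω | V ω < -z - βh * w} = Aᶜ := by
    ext ω
    exact (not_le (a := -z - βh * w) (b := V ω)).symm
  have hpos : ∫ ω, max (V ω + (z + βh * w)) 0 ∂P
      = ∫ ω in A, max (V ω + (z + βh * w)) 0 ∂P := by
    refine (setIntegral_eq_integral_of_forall_compl_eq_zero fun ω hω => max_eq_right ?_).symm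
    have : V ω < -z - βh * w := not_le.mp hω
    linarith
  have hsplit : ∫ ω in A, (V ω + w) ∂P
      = ∫ ω in A, (max (V ω + (z + βh * w)) 0 + ((1 - βh) * w - z)) ∂P := by
    refine setIntegral_congr_fun hAm fun ω hω => ?_
    have : -z - βh * w ≤ V ω := hω
    change V ω + w = max (V ω + (z + βh * w)) 0 + ((1 - βh) * w - z)
    rw [max_eq_left (by linarith)]
    ring
  have hprob : (P Aᶜ).toReal = 1 - P.real A := probReal_compl_eq_one_sub hAm
  rw [uhat, hcompl, hprob, hcdf, hpos, hsplit,
    integral_add hint.integrableOn (integrable_const _), setIntegral_const, smul_eq_mul]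
  ring

end

/-- `û` is upper semicontinuous; in particular, for every `z*`,
`limsup_{z ↑ z*} û(z) ≤ û(z*)`. -/
theorem uhat_upperSemicontinuous {Ω : Type*} [MeasurableSpace Ω] (P : Measure Ω)
    [IsProbabilityMeasure P] (V : Ω → ℝ) (hV : Measurable V)
    (w : ℝ) (hw : 0 ≤ w) (βh : ℝ) (hβh : βh ∈ Set.Icc (0 : ℝ) 1)
    (hA2 : Integrable (fun ω => max (V ω + w) 0) P) :
    UpperSemicontinuous (fun z => uhat P V w βh z)
      ∧ ∀ zs : ℝ, Filter.limsup (fun z => uhat P V w βh z)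
          (nhdsWithin zs (Set.Iio zs)) ≤ uhat P V w βh zs := by
  have hint := integrable_max_add_zero hV hA2
  have heq := fun z => uhat_eq hV w βh z (hint (z + βh * w))
  have hc : 0 ≤ (1 - βh) * w := mul_nonneg (sub_nonneg.mpr hβh.2) hw
  set F := ProbabilityTheory.cdf (P.map fun ω => -V ω - βh * w)
  have husc : UpperSemicontinuous fun z => uhat P V w βh z := by
    simp only [heq]
    have hcont : Continuous fun z : ℝ => -z + ∫ ω, max (V ω + (z + βh * w)) 0 ∂P :=
      continuous_neg.add ((continuous_integral_max_add_zero hint).comp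
        (continuous_id.add continuous_const))
    exact hcont.upperSemicontinuous.add <|
      (continuous_const_mul ((1 - βh) * w)).comp_upperSemicontinuous
        F.upperSemicontinuous (monotone_mul_left_of_nonneg hc)
  refine ⟨husc, fun zs => le_of_forall_gt_imp_ge_of_dense fun y hy => ?_⟩
  have hlower : ∀ᶠ z in nhdsWithin zs (Iio zs), -zs ≤ uhat P V w βh z := by
    filter_upwards [self_mem_nhdsWithin] with z hz
    have hz : z < zs := hz
    have hE : 0 ≤ ∫ ω, max (V ω + (z + βh * w)) 0 ∂P :=
      integral_nonneg fun ω => le_max_right _ _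
    have hF : 0 ≤ (1 - βh) * w * F z := mul_nonneg hc (ProbabilityTheory.cdf_nonneg _ _)
    rw [heq]
    linarith
  refine limsup_le_of_le (IsBoundedUnder.isCoboundedUnder_le ⟨-zs, eventually_map.mpr hlower⟩) ?_
  exact ((husc zs y hy).filter_mono nhdsWithin_le_nhds).mono fun z hz => hz.le
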